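/- arXiv:2411.06497 — 2 statements merged into one kernel-verified Lean document; each statement's English description precedes it below -/
import Mathlib

section
/- Let A and B be n×n positive-semidefinite Hermitian complex matrices with eigenvalues listed in decreasing order λ₁ ≥ λ₂ ≥ … ≥ λₙ and μ₁ ≥ μ₂ ≥ … ≥ μₙ respectively. Then the trace of A·B is a real number and satisfies tr(AB) ≥ Σ_{i=1}^{n} λ_i · μ_{n+1−i}. -/
open Matrix Finset
open scoped ComplexOrder

/-- The squared moduli of the entries of a unitary matrix form a doubly stochastic matrix. -/
theorem normSq_mem_doublyStochastic {ι : Type*} [Fintype ι] [DecidableEq ι]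
    (W : unitaryGroup ι ℂ) :
    (Matrix.of fun i j => Complex.normSq (W.1 i j)) ∈ doublyStochastic ℝ ι := by
  rw [mem_doublyStochastic_iff_sum]
  refine ⟨fun i j => Complex.normSq_nonneg _, fun i => ?_, fun j => ?_⟩
  · have h : (W.1 * star W.1) i i = 1 := by rw [Unitary.mul_star_self_of_mem W.2, one_apply_eq]
    simp only [mul_apply, star_apply, RCLike.star_def, Complex.mul_conj] at h
    exact_mod_cast h
  · have h : (star W.1 * W.1) j j = 1 := by rw [Unitary.star_mul_self_of_mem W.2, one_apply_eq]
    simp only [mul_apply, star_apply, RCLike.star_def, mul_comm (starRingEnd ℂ _),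
      Complex.mul_conj] at h
    exact_mod_cast h

/-- A lower bound for all `∑ i, a i * b (τ i)`, with `τ` a permutation, extends to
doubly stochastic matrices. -/
theorem le_sum_of_mem_doublyStochastic {ι : Type*} [Fintype ι] [DecidableEq ι]
    {M : Matrix ι ι ℝ} (hM : M ∈ doublyStochastic ℝ ι) {a b : ι → ℝ} {c : ℝ}
    (h : ∀ τ : Equiv.Perm ι, c ≤ ∑ i, a i * b (τ i)) :
    c ≤ ∑ i, ∑ j, M i j * (a i * b j) := by
  obtain ⟨w, hw0, hw1, rfl⟩ := exists_eq_sum_perm_of_mem_doublyStochastic hM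
  have key : ∑ i, ∑ j, (∑ τ, w τ • τ.permMatrix ℝ) i j * (a i * b j)
      = ∑ τ, w τ * ∑ i, a i * b (τ i) := by
    simp only [Matrix.sum_apply, Matrix.smul_apply, smul_eq_mul, sum_mul, mul_sum]
    simp_rw [sum_comm (s := univ (α := ι)) (t := univ (α := Equiv.Perm ι))]
    simp [Equiv.Perm.permMatrix, PEquiv.toMatrix_apply, eq_comm]
  rw [key]
  calc c = ∑ τ, w τ * c := by rw [← sum_mul, hw1, one_mul]
    _ ≤ _ := sum_le_sum fun τ _ => mul_le_mul_of_nonneg_left (h τ) (hw0 τ)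

/-- The trace of a product of Hermitian matrices in terms of their eigenvalues and the overlaps
of their eigenvectors. -/
theorem Matrix.IsHermitian.trace_mul_eq_sum {ι : Type*} [Fintype ι] [DecidableEq ι]
    {A B : Matrix ι ι ℂ} (hA : A.IsHermitian) (hB : B.IsHermitian) :
    (A * B).trace = ((∑ i, ∑ j,
      Complex.normSq ((star hA.eigenvectorUnitary * hB.eigenvectorUnitary).1 i j) *
        (hA.eigenvalues i * hB.eigenvalues j) : ℝ) : ℂ) := by
  set W := star hA.eigenvectorUnitary * hB.eigenvectorUnitary with hW
  have h : (A * B).trace = (diagonal (fun i => (hA.eigenvalues i : ℂ)) * W.1 *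
      (diagonal (fun i => (hB.eigenvalues i : ℂ)) * star W.1)).trace := by
    conv_lhs => rw [hA.spectral_theorem, hB.spectral_theorem]
    simp only [Unitary.conjStarAlgAut_apply, hW, Submonoid.coe_mul, Unitary.coe_star, star_mul,
      star_star, Matrix.mul_assoc]
    rw [trace_mul_comm]
    simp only [Matrix.mul_assoc]
    rfl
  rw [h]
  simp only [trace, diag_apply, mul_apply (M := _ * W.1), diagonal_mul, star_apply,
    RCLike.star_def]
  push_cast
  refine sum_congr rfl fun i _ => sum_congr rfl fun j _ => ?_
  rw [← Complex.mul_conj]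
  ring

/-- **Trace inequality for positive-semidefinite matrices (after (2.14)).**
Let `A`, `B` be `n × n` positive-semidefinite Hermitian complex matrices with
eigenvalues enumerated in decreasing order as `lam 0 ≥ … ≥ lam (n-1)` and
`mu 0 ≥ … ≥ mu (n-1)`. Then `tr(AB)` is real and
`tr(AB) ≥ Σ_i lam i · mu (rev i)`, i.e. the sum pairs the `i`-th largest
eigenvalue of `A` with the `i`-th smallest eigenvalue of `B`. -/
theorem trace_mul_ge_sum_eigenvalues_antitone {n : ℕ}
    (A B : Matrix (Fin n) (Fin n) ℂ)
    (hA : A.PosSemidef) (hB : B.PosSemidef)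
    (lam mu : Fin n → ℝ)
    (hlamA : ∃ σ : Equiv.Perm (Fin n), lam = hA.1.eigenvalues ∘ σ)
    (hmuB : ∃ σ : Equiv.Perm (Fin n), mu = hB.1.eigenvalues ∘ σ)
    (hlam : Antitone lam) (hmu : Antitone mu) :
    ((A * B).trace).im = 0 ∧
      ∑ i : Fin n, lam i * mu i.rev ≤ ((A * B).trace).re := by
  rw [hA.1.trace_mul_eq_sum hB.1]
  refine ⟨Complex.ofReal_im _, ?_⟩
  rw [Complex.ofReal_re]
  obtain ⟨σ, hσ⟩ := hlamA
  obtain ⟨ρ, hρ⟩ := hmuB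
  refine le_sum_of_mem_doublyStochastic (normSq_mem_doublyStochastic _) fun τ => ?_
  have hanti : Antivary lam (mu ∘ Fin.rev) :=
    hlam.antivary (hmu.comp Fin.rev_anti)
  calc ∑ i, lam i * mu i.rev
      ≤ ∑ i, lam i * (mu ∘ Fin.rev) ((σ.trans (τ.trans (ρ.symm.trans Fin.revPerm))) i) :=
        hanti.sum_mul_le_sum_mul_comp_perm
    _ = ∑ i, hA.1.eigenvalues (σ i) * hB.1.eigenvalues (τ (σ i)) := by simp [hσ, hρ]
    _ = _ := Equiv.sum_comp σ fun i => hA.1.eigenvalues i * hB.1.eigenvalues (τ i)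
end

section
/- Let P, Q, R be real n×n matrices with P and R symmetric, and suppose the symmetric 2n×2n block matrix M = [[P, Q], [Qᵀ, R]] is positive semidefinite. Let H be the Hermitian n×n complex matrix H = (1/4)(P + R + i(Qᵀ − Q)). Then det M ≤ 2^{2n} · (Re det H)². -/
open Matrix

open scoped ComplexOrder MatrixOrder in
/-- A positive semidefinite matrix is a Gram matrix. -/
theorem Matrix.PosSemidef.exists_eq_conjTranspose_mul_self {𝕜 m : Type*} [RCLike 𝕜] [Fintype m]
    [DecidableEq m] {X : Matrix m m 𝕜} (hX : X.PosSemidef) : ∃ C : Matrix m m 𝕜, X = Cᴴ * C :=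
  CStarAlgebra.nonneg_iff_eq_star_mul_self.mp hX.nonneg

open scoped ComplexOrder in
theorem Matrix.PosSemidef.one_le_det_one_add {𝕜 m : Type*} [RCLike 𝕜] [Fintype m]
    [DecidableEq m] {K : Matrix m m 𝕜} (hK : K.PosSemidef) : 1 ≤ (1 + K).det := by
  have h : (1 + K).det = ∏ i, ((1 + hK.1.eigenvalues i : ℝ) : 𝕜) := by
    have h1 : (1 + K).det = (-1) ^ Fintype.card m * K.charpoly.eval (-1) := by
      rw [Matrix.eval_charpoly, ← Matrix.det_neg]
      congr 1
      simp [sub_eq_add_neg, add_comm]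
    rw [h1, hK.1.charpoly_eq, Polynomial.eval_prod, ← Finset.card_univ, ← Finset.prod_const,
      ← Finset.prod_mul_distrib]
    refine Finset.prod_congr rfl fun i _ => ?_
    simp
    ring
  rw [h, ← map_prod (algebraMap ℝ 𝕜), ← map_one (algebraMap ℝ 𝕜)]
  refine RCLike.ofReal_le_ofReal.mpr ?_
  calc (1 : ℝ) = ∏ _i : m, (1 : ℝ) := by simp
    _ ≤ ∏ i, (1 + hK.1.eigenvalues i) := Finset.prod_le_prod (fun _ _ => zero_le_one)
      fun i _ => by linarith [hK.eigenvalues_nonneg i]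

open scoped ComplexOrder in
/-- The determinant is monotone on positive semidefinite matrices. -/
theorem Matrix.PosSemidef.det_le_det_add {𝕜 m : Type*} [RCLike 𝕜] [Fintype m] [DecidableEq m]
    {X K : Matrix m m 𝕜} (hX : X.PosSemidef) (hK : K.PosSemidef) : X.det ≤ (X + K).det := by
  by_cases h : X.det = 0
  · rw [h]
    exact (hX.add hK).det_nonneg
  obtain ⟨C, rfl⟩ := hX.exists_eq_conjTranspose_mul_self
  have hC : IsUnit C.det := by
    rw [det_mul] at h
    exact (right_ne_zero_of_mul h).isUnit
  have hC' : IsUnit Cᴴ.det := by rw [det_conjTranspose]; exact hC.star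
  have e : Cᴴ * C + K = Cᴴ * (1 + (C⁻¹)ᴴ * K * C⁻¹) * C := by
    rw [mul_add, add_mul, mul_one, conjTranspose_nonsing_inv]
    simp only [← mul_assoc, mul_nonsing_inv _ hC', one_mul]
    rw [mul_assoc K, nonsing_inv_mul _ hC, mul_one]
  have e' : (Cᴴ * C + K).det = (Cᴴ * C).det * (1 + (C⁻¹)ᴴ * K * C⁻¹).det := by
    rw [e, det_mul, det_mul, det_mul]
    ring
  rw [e']
  exact le_mul_of_one_le_right hX.det_nonneg
    (hK.conjTranspose_mul_mul_same C⁻¹).one_le_det_one_add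

open scoped ComplexOrder in
/-- **Fischer's inequality**. -/
theorem Matrix.PosDef.det_fromBlocks_le {𝕜 m k : Type*} [RCLike 𝕜] [Fintype m] [DecidableEq m]
    [Fintype k] [DecidableEq k] {A : Matrix m m 𝕜} {B : Matrix m k 𝕜} {D : Matrix k k 𝕜}
    (hM : (fromBlocks A B Bᴴ D).PosDef) : (fromBlocks A B Bᴴ D).det ≤ A.det * D.det := by
  have hA : A.PosDef := hM.submatrix (e := Sum.inl) Sum.inl_injective
  let := hA.isUnit.invertible
  have hS : (D - Bᴴ * A⁻¹ * B).PosSemidef := (PosDef.fromBlocks₁₁ B D hA).mp hM.posSemidef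
  have h := hS.det_le_det_add (hA.posSemidef.inv.conjTranspose_mul_mul_same B)
  rw [sub_add_cancel] at h
  rw [det_fromBlocks₁₁, invOf_eq_nonsing_inv]
  exact mul_le_mul_of_nonneg_left h hA.posSemidef.det_nonneg

open scoped ComplexOrder in
theorem Matrix.PosSemidef.map_ofReal {m : Type*} [Fintype m] [DecidableEq m]
    {M : Matrix m m ℝ} (hM : M.PosSemidef) : (M.map Complex.ofReal).PosSemidef := by
  obtain ⟨C, rfl⟩ := hM.exists_eq_conjTranspose_mul_self
  have e : (Cᴴ * C).map Complex.ofReal = (C.map Complex.ofReal)ᴴ * C.map Complex.ofReal := by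
    ext i j
    simp [Matrix.mul_apply]
  rw [e]
  exact posSemidef_conjTranspose_mul_self _

/-- **Determinant inequality for the upper contact set (item (ii) of the C⁰
estimate).**
Let `P`, `Q`, `R` be real `n × n` matrices with `P` and `R` symmetric, and
suppose the symmetric block matrix `M = [[P, Q], [Qᵀ, R]]` is positive
semidefinite. With `H = (1/4)(P + R + i(Qᵀ − Q))` (a Hermitian complex matrix),
one has `det M ≤ 2^{2n} (Re det H)²`. -/
theorem det_real_hessian_le_complex_hessian {n : ℕ}
    (P Q R : Matrix (Fin n) (Fin n) ℝ)
    (hP : P.IsSymm) (hR : R.IsSymm)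
    (hM : (Matrix.fromBlocks P Q Qᵀ R).PosSemidef) :
    (Matrix.fromBlocks P Q Qᵀ R).det ≤
      2 ^ (2 * n) *
        ((((1 / 4 : ℂ) • ((P.map (Complex.ofReal) + R.map (Complex.ofReal)) +
          Complex.I • (Qᵀ.map (Complex.ofReal) - Q.map (Complex.ofReal)))).det).re) ^ 2 := by
  open scoped ComplexOrder in
  by_cases hdet : (fromBlocks P Q Qᵀ R).det = 0
  · rw [hdet]
    positivity
  set A : Matrix (Fin n) (Fin n) ℂ := (P.map Complex.ofReal + R.map Complex.ofReal) +
    Complex.I • (Qᵀ.map Complex.ofReal - Q.map Complex.ofReal) with hA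
  set M := fromBlocks P Q Qᵀ R
  set B : Matrix (Fin n) (Fin n) ℂ := (P.map Complex.ofReal - R.map Complex.ofReal) +
    Complex.I • (Qᵀ.map Complex.ofReal + Q.map Complex.ofReal) with hB
  let W : Matrix (Fin n ⊕ Fin n) (Fin n ⊕ Fin n) ℂ :=
    fromBlocks 1 1 (-Complex.I • 1) (Complex.I • 1)
  have hWh : Wᴴ = fromBlocks 1 (Complex.I • 1) 1 (-Complex.I • 1) := by
    simp [W, fromBlocks_conjTranspose, conjTranspose_smul]
  have hP' : ∀ i j, P i j = P j i := fun i j => hP.apply j i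
  have hR' : ∀ i j, R i j = R j i := fun i j => hR.apply j i
  have hWMW : Wᴴ * M.map Complex.ofReal * W = fromBlocks A B Bᴴ Aᵀ := by
    rw [hWh]
    simp only [W, M, fromBlocks_map, fromBlocks_multiply]
    congr 1 <;> ext i j <;> simp [hA, hB, hP' i j, hR' i j] <;> ring_nf <;> simp <;> ring
  have hWW : Wᴴ.det * W.det = 4 ^ n := by
    have e : Wᴴ * W = (2 : ℂ) • 1 := by
      rw [hWh]
      simp only [W, fromBlocks_multiply, ← fromBlocks_one, fromBlocks_smul]
      congr 1 <;> simp [smul_smul, two_smul]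
    rw [← det_mul, e, det_smul]
    simp [← two_mul, pow_mul]
    norm_num
  have hdetM : (M.map Complex.ofReal).det = (M.det : ℂ) := (RingHom.map_det Complex.ofRealHom M).symm
  have hdetWMW : (Wᴴ * M.map Complex.ofReal * W).det = ((4 ^ n * M.det : ℝ) : ℂ) := by
    rw [det_mul, det_mul, hdetM, mul_right_comm, hWW]
    push_cast
    rfl
  have hpd : (fromBlocks A B Bᴴ Aᵀ).PosDef := by
    rw [← hWMW, (hM.map_ofReal.conjTranspose_mul_mul_same W).posDef_iff_det_ne_zero, hdetWMW]
    exact_mod_cast mul_ne_zero (by positivity) hdet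
  have hfischer := hpd.det_fromBlocks_le
  have hApd : A.PosDef := hpd.submatrix (e := Sum.inl) Sum.inl_injective
  have hreal : A.det = (A.det.re : ℂ) := Complex.eq_re_of_ofReal_le hApd.det_pos.le
  rw [← hWMW, hdetWMW, det_transpose, hreal, ← Complex.ofReal_mul, Complex.real_le_real] at hfischer
  have hre : ((1 / 4 : ℂ) • A).det.re = (1 / 4) ^ n * A.det.re := by
    rw [det_smul, hreal, Fintype.card_fin]
    have : (1 / 4 : ℂ) ^ n = (((1 / 4) ^ n : ℝ) : ℂ) := by push_cast; rfl
    rw [this, ← Complex.ofReal_mul, Complex.ofReal_re, Complex.ofReal_re]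
  rw [hre, pow_mul]
  have h4 : (1 / 4 : ℝ) ^ n * 4 ^ n = 1 := by rw [← mul_pow]; norm_num
  calc M.det = (1 / 4 : ℝ) ^ n * (4 ^ n * M.det) := by rw [← mul_assoc, h4, one_mul]
    _ ≤ (1 / 4 : ℝ) ^ n * (A.det.re * A.det.re) := by gcongr
    _ = ((1 / 4 : ℝ) ^ n * 4 ^ n) * ((1 / 4 : ℝ) ^ n * (A.det.re * A.det.re)) := by
      rw [h4, one_mul]
    _ = (2 ^ 2) ^ n * ((1 / 4) ^ n * A.det.re) ^ 2 := by
      norm_num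
      ring
end
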